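/- arXiv:0710.1950 — 2 statements merged into one kernel-verified Lean document; each statement's English description precedes it below -/
import Mathlib

section
/- Let h > 0, k > 0, n_cl > 0, and let n : ℝ → ℝ be a bounded measurable function with n(x) = n_cl for all |x| > h. If u belongs to the Sobolev space H²(ℝ²) and satisfies Δu + k² n(x)² u = 0 almost everywhere in ℝ² (the Laplacian taken in the weak/distributional sense), then u = 0 almost everywhere in ℝ². -/
open MeasureTheory Filter Set Complex
open scoped ENNReal NNReal

noncomputable section

/-- Partial derivative in the first variable of a real-valued function on `ℝ × ℝ`. -/
def pdxR (F : ℝ × ℝ → ℝ) (p : ℝ × ℝ) : ℝ := deriv (fun t => F (t, p.2)) p.1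

/-- Partial derivative in the second variable of a real-valued function on `ℝ × ℝ`. -/
def pdzR (F : ℝ × ℝ → ℝ) (p : ℝ × ℝ) : ℝ := deriv (fun t => F (p.1, t)) p.2

/-- Smooth compactly supported real-valued test function on `ℝ × ℝ`. -/
def IsTest (φ : ℝ × ℝ → ℝ) : Prop := ContDiff ℝ (⊤ : ℕ∞) φ ∧ HasCompactSupport φ

/-- `v` is the weak partial derivative in the first variable of `u`:
`∫ u ∂ₓφ = -∫ v φ` for all test functions `φ`. -/
def IsWeakPdx (u v : ℝ × ℝ → ℂ) : Prop :=
  ∀ φ : ℝ × ℝ → ℝ, IsTest φ →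
    (∫ p : ℝ × ℝ, u p * (pdxR φ p : ℂ)) = -∫ p : ℝ × ℝ, v p * (φ p : ℂ)

/-- `v` is the weak partial derivative in the second variable of `u`. -/
def IsWeakPdz (u v : ℝ × ℝ → ℂ) : Prop :=
  ∀ φ : ℝ × ℝ → ℝ, IsTest φ →
    (∫ p : ℝ × ℝ, u p * (pdzR φ p : ℂ)) = -∫ p : ℝ × ℝ, v p * (φ p : ℂ)

open scoped Topology ContDiff InnerProductSpace

abbrev HH := Lp ℂ 2 (volume : Measure ℝ)

theorem mp_add (s : ℝ) : MeasurePreserving (fun x : ℝ => x + s) volume volume :=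
  measurePreserving_add_right volume s

/-- translation on `L²(ℝ)` -/
def TT (s : ℝ) : HH →ₗᵢ[ℂ] HH := Lp.compMeasurePreservingₗᵢ ℂ (fun x : ℝ => x + s) (mp_add s)

theorem TT_coe (s : ℝ) (f : HH) : TT s f =ᵐ[volume] fun x => f (x + s) :=
  Lp.coeFn_compMeasurePreserving f (mp_add s)

theorem TT_cont (f : HH) : Continuous (fun s => TT s f) := by
  have := Continuous.compMeasurePreservingLp (μ := (volume : Measure ℝ)) (ν := (volume : Measure ℝ))
    (p := 2) (f := fun _ : ℝ => f)
    (g := fun s : ℝ => (⟨fun x : ℝ => x + s, by fun_prop⟩ : C(ℝ, ℝ))) continuous_const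
    (by
      refine ContinuousMap.continuous_of_continuous_uncurry _ ?_
      change Continuous (fun p : ℝ × ℝ => p.2 + p.1)
      fun_prop) (fun s => mp_add s) (by norm_num)
  exact this

theorem TT_zero (f : HH) : TT 0 f = f := by
  apply Lp.ext
  filter_upwards [TT_coe 0 f] with x hx
  rw [hx, add_zero]

/-- one-dimensional test functions -/
def IsT (φ : ℝ → ℝ) : Prop := ContDiff ℝ ∞ φ ∧ HasCompactSupport φ

theorem IsT.memLp {φ : ℝ → ℝ} (h : IsT φ) : MemLp (fun x => (φ x : ℂ)) 2 (volume : Measure ℝ) := by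
  have hc : Continuous (fun x => (φ x : ℂ)) := Complex.continuous_ofReal.comp h.1.continuous
  exact hc.memLp_of_hasCompactSupport (h.2.comp_left (g := fun y : ℝ => (y : ℂ)) (by simp))

/-- class in `L²` of a test function -/
def cl (φ : ℝ → ℝ) (h : IsT φ) : HH := h.memLp.toLp _

theorem cl_coe {φ : ℝ → ℝ} (h : IsT φ) : cl φ h =ᵐ[volume] fun x => (φ x : ℂ) :=
  MemLp.coeFn_toLp _

theorem IsT.deriv {φ : ℝ → ℝ} (h : IsT φ) : IsT (deriv φ) :=
  ⟨((contDiff_infty_iff_deriv).1 h.1).2, h.2.deriv⟩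

theorem IsT.shift {φ : ℝ → ℝ} (h : IsT φ) (s : ℝ) : IsT (fun x => φ (x + s)) :=
  ⟨h.1.comp (contDiff_id.add contDiff_const), h.2.comp_homeomorph (Homeomorph.addRight s)⟩

theorem TT_cl {φ : ℝ → ℝ} (h : IsT φ) (s : ℝ) : TT s (cl φ h) = cl _ (h.shift s) := rfl

theorem deriv_shift (φ : ℝ → ℝ) (s : ℝ) :
    deriv (fun x => φ (x + s)) = fun x => deriv φ (x + s) := by
  ext x; exact deriv_comp_add_const φ s x

theorem inner_cl {φ : ℝ → ℝ} (h : IsT φ) (f : HH) : ⟪cl φ h, f⟫_ℂ = ∫ x, f x * (φ x : ℂ) := by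
  rw [L2.inner_def]
  refine integral_congr_ae ?_
  filter_upwards [cl_coe h] with x hx
  rw [hx]; simp [RCLike.inner_apply]

theorem eq_zero_of_inner_cl (f : HH) (hf : ∀ φ (h : IsT φ), ⟪cl φ h, f⟫_ℂ = 0) : f = 0 := by
  have := ae_eq_zero_of_integral_contDiff_smul_eq_zero (μ := (volume : Measure ℝ)) (f := f)
    ((Lp.memLp f).locallyIntegrable (by norm_num)) (fun g hg hc => by
      have := (inner_cl ⟨hg, hc⟩ f).symm.trans (hf g ⟨hg, hc⟩)
      rw [← this]
      congr 1; ext x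
      simp [mul_comm])
  exact (Lp.eq_zero_iff_ae_eq_zero).2 this

/-- weak derivative in one variable -/
def WD (f f' : HH) : Prop := ∀ φ (h : IsT φ), ⟪cl _ h.deriv, f⟫_ℂ = - ⟪cl φ h, f'⟫_ℂ

theorem inner_TT {φ : ℝ → ℝ} (h : IsT φ) (f : HH) (s : ℝ) :
    ⟪cl φ h, TT s f⟫_ℂ = ⟪cl _ (h.shift (-s)), f⟫_ℂ := by
  rw [← (TT s).inner_map_map (cl _ (h.shift (-s))) f, TT_cl]
  congr 2; ext x; simp

theorem inner_TT_hasDerivAt {f f' : HH} (hw : WD f f') {φ : ℝ → ℝ} (h : IsT φ) (s : ℝ) :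
    HasDerivAt (fun s => ⟪cl φ h, TT s f⟫_ℂ) ⟪cl φ h, TT s f'⟫_ℂ s := by
  have hr : IsT (fun x => φ (-x)) :=
    ⟨h.1.comp contDiff_neg, h.2.comp_homeomorph (Homeomorph.neg ℝ)⟩
  have hr' := hr.memLp
  have hcd : ContDiff ℝ 1 (fun x => ((φ (-x) : ℝ) : ℂ)) :=
    (Complex.ofRealCLM.contDiff.comp hr.1).of_le (by norm_num)
  have key := HasCompactSupport.hasDerivAt_convolution_right (𝕜 := ℝ) (μ := (volume : Measure ℝ))
    (ContinuousLinearMap.mul ℝ ℂ) (f₀ := (f : ℝ → ℂ)) (g₀ := fun x => ((φ (-x) : ℝ) : ℂ))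
    ((Lp.memLp f).locallyIntegrable (by norm_num))
    (hr.2.comp_left (g := fun y : ℝ => (y : ℂ)) (by simp)) hcd s
  have e1 : (fun s => ⟪cl φ h, TT s f⟫_ℂ) = convolution (f : ℝ → ℂ) (fun x => ((φ (-x) : ℝ) : ℂ))
      (ContinuousLinearMap.mul ℝ ℂ) volume := by
    ext s
    rw [inner_TT, inner_cl, convolution_def]
    congr 1; ext x
    simp [sub_eq_add_neg]
  have e2 : ⟪cl φ h, TT s f'⟫_ℂ = convolution (f : ℝ → ℂ) (_root_.deriv (fun x => ((φ (-x) : ℝ) : ℂ)))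
      (ContinuousLinearMap.mul ℝ ℂ) volume s := by
    rw [inner_TT, ← neg_eq_iff_eq_neg.2 (hw _ (h.shift (-s))), inner_cl, convolution_def,
      ← integral_neg]
    congr 1; ext x
    have hd : HasDerivAt (fun x => ((φ (-x) : ℝ) : ℂ)) ((-(_root_.deriv φ (-(s - x))) : ℝ) : ℂ) (s - x) := by
      apply HasDerivAt.ofReal_comp
      have h1 : HasDerivAt φ (_root_.deriv φ (-(s-x))) (-(s-x)) :=
        (h.1.differentiable (by simp) _).hasDerivAt
      simpa using! h1.comp (s-x) (hasDerivAt_neg (s-x))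
    rw [hd.deriv, deriv_shift]
    simp [sub_eq_add_neg]
  rw [e1, e2]; exact key

theorem TT_eq {f f' : HH} (hw : WD f f') (s : ℝ) :
    TT s f = f + ∫ r in (0:ℝ)..s, TT r f' := by
  rw [← sub_eq_zero]
  apply eq_zero_of_inner_cl
  intro φ h
  have hci : IntervalIntegrable (fun r => TT r f') volume 0 s := (TT_cont f').intervalIntegrable _ _
  have h1 : ⟪cl φ h, ∫ r in (0:ℝ)..s, TT r f'⟫_ℂ = ∫ r in (0:ℝ)..s, ⟪cl φ h, TT r f'⟫_ℂ :=
    ((innerSL ℂ (cl φ h)).intervalIntegral_comp_comm hci).symm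
  have h2 : ∫ r in (0:ℝ)..s, ⟪cl φ h, TT r f'⟫_ℂ = ⟪cl φ h, TT s f⟫_ℂ - ⟪cl φ h, TT 0 f⟫_ℂ := by
    apply intervalIntegral.integral_eq_sub_of_hasDerivAt
    · intro x _; exact inner_TT_hasDerivAt hw h x
    · apply Continuous.intervalIntegrable
      exact continuous_const.inner (TT_cont f')
  rw [inner_sub_right, inner_add_right, h1, h2, TT_zero]
  ring

theorem TT_hasDerivAt {f f' : HH} (hw : WD f f') (s : ℝ) :
    HasDerivAt (fun s => TT s f) (TT s f') s := by
  have : (fun s => TT s f) = fun s => f + ∫ r in (0:ℝ)..s, TT r f' := by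
    ext1 s; exact TT_eq hw s
  rw [this]
  exact ((TT_cont f').integral_hasStrictDerivAt 0 s).hasDerivAt.const_add f

theorem WD_parts {f f' g g' : HH} (hf : WD f f') (hg : WD g g') :
    ⟪f', g⟫_ℂ = - ⟪f, g'⟫_ℂ := by
  have h := (TT_hasDerivAt hf 0).inner ℂ (TT_hasDerivAt hg 0)
  have e : (fun s => ⟪TT s f, TT s g⟫_ℂ) = fun _ => ⟪f, g⟫_ℂ := by
    ext s; exact (TT s).inner_map_map f g
  rw [e] at h
  have := h.unique (hasDerivAt_const _ _)
  simp only [TT_zero] at this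
  linear_combination this

theorem cl_WD {φ : ℝ → ℝ} (h : IsT φ) : WD (cl φ h) (cl _ h.deriv) := by
  intro η hη
  rw [inner_cl, inner_cl]
  have e1 : ∫ x, (cl φ h) x * ((_root_.deriv η x : ℝ) : ℂ) = ((∫ x, φ x * _root_.deriv η x : ℝ) : ℂ) := by
    rw [← integral_complex_ofReal]
    refine integral_congr_ae ?_
    filter_upwards [cl_coe h] with x hx
    rw [hx]; simp
  have e2 : ∫ x, (cl _ h.deriv) x * ((η x : ℝ) : ℂ) = ((∫ x, _root_.deriv φ x * η x : ℝ) : ℂ) := by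
    rw [← integral_complex_ofReal]
    refine integral_congr_ae ?_
    filter_upwards [cl_coe h.deriv] with x hx
    rw [hx]; simp
  rw [e1, e2, ← Complex.ofReal_neg]
  congr 1
  have c1 := h.1.continuous
  have c2 := hη.1.continuous
  have c3 := h.deriv.1.continuous
  have c4 := hη.deriv.1.continuous
  apply integral_mul_deriv_eq_deriv_mul_of_integrable
  · intro x _; exact (h.1.differentiable (by simp) _).hasDerivAt
  · intro x _; exact (hη.1.differentiable (by simp) _).hasDerivAt
  · exact (c1.mul c4).integrable_of_hasCompactSupport h.2.mul_right
  · exact (c3.mul c2).integrable_of_hasCompactSupport hη.2.mul_left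
  · exact (c1.mul c2).integrable_of_hasCompactSupport h.2.mul_right

theorem abstract_zero {A0 A1 A2 : ℝ → HH} (h0 : ∀ s, HasDerivAt A0 (A1 s) s)
    (h1 : ∀ s, HasDerivAt A1 (A2 s) s) (C : ℝ) (b0 : ∀ s, ‖A0 s‖ ≤ C) (b1 : ∀ s, ‖A1 s‖ ≤ C)
    (t0 : Tendsto A0 atTop (𝓝 0)) (t1 : Tendsto A1 atTop (𝓝 0))
    (hs : ∀ s t, ⟪A2 s, A0 t⟫_ℂ = ⟪A0 s, A2 t⟫_ℂ) : A0 0 = 0 := by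
  have tz : ∀ (P Q : ℝ → HH), Tendsto P atTop (𝓝 0) → (∀ s, ‖Q s‖ ≤ C) →
      Tendsto (fun r => ⟪P r, Q r⟫_ℂ) atTop (𝓝 0) := by
    intro P Q hP hQ
    apply squeeze_zero_norm (a := fun r => ‖P r‖ * C)
    · intro r
      exact (norm_inner_le_norm _ _).trans (by gcongr; exact hQ r)
    · simpa using hP.norm.mul_const C
  have cst : ∀ W : ℝ → ℂ, (∀ r, HasDerivAt W 0 r) → Tendsto W atTop (𝓝 0) → ∀ r, W r = 0 := by
    intro W hW hT r
    have hc : ∀ x y, W x = W y := is_const_of_deriv_eq_zero (fun x => (hW x).differentiableAt)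
      (fun x => (hW x).deriv)
    have : Tendsto W atTop (𝓝 (W r)) := by
      have e : W = fun _ => W r := by ext x; exact hc x r
      rw [e]; exact tendsto_const_nhds
    exact tendsto_nhds_unique this hT
  have rev : ∀ (Q Q' : ℝ → HH), (∀ s, HasDerivAt Q (Q' s) s) → ∀ c r,
      HasDerivAt (fun r => Q (c - r)) (- Q' (c - r)) r := by
    intro Q Q' hQ c r
    have := (hQ (c - r)).scomp r ((hasDerivAt_id r).const_sub c)
    simpa using! this
  have W0 : ∀ c r, ⟪A1 r, A0 (c - r)⟫_ℂ + ⟪A0 r, A1 (c - r)⟫_ℂ = 0 := by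
    intro c
    apply cst (fun r => ⟪A1 r, A0 (c - r)⟫_ℂ + ⟪A0 r, A1 (c - r)⟫_ℂ)
    · intro r
      have d := ((h1 r).inner ℂ (rev _ _ h0 c r)).add ((h0 r).inner ℂ (rev _ _ h1 c r))
      convert! d using 1
      simp only [inner_neg_right]
      rw [hs]; ring
    · have := (tz A1 (fun r => A0 (c - r)) t1 (fun r => b0 _)).add
        (tz A0 (fun r => A1 (c - r)) t0 (fun r => b1 _))
      simpa using this
  have F0 : ∀ r, ⟪A0 r, A0 r⟫_ℂ = 0 := by
    apply cst (fun r => ⟪A0 r, A0 r⟫_ℂ)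
    · intro r
      have d := (h0 r).inner ℂ (h0 r)
      convert! d using 1
      have := W0 (r + r) r
      simp only [add_sub_cancel_right] at this
      linear_combination -this
    · exact tz A0 A0 t0 b0
  exact inner_self_eq_zero.1 (F0 0)

theorem norm_sq_HH (g : HH) : ‖g‖ ^ 2 = ∫ x, ‖g x‖ ^ 2 := by
  have h := L2.inner_def (𝕜 := ℂ) g g
  rw [inner_self_eq_norm_sq_to_K] at h
  have h2 : ∫ x, ⟪g x, g x⟫_ℂ = ((∫ x, ‖g x‖ ^ 2 : ℝ) : ℂ) := by
    rw [← integral_complex_ofReal]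
    congr 1; ext x
    rw [inner_self_eq_norm_sq_to_K]; simp
  rw [h2] at h
  have h3 : ((‖g‖ ^ 2 : ℝ) : ℂ) = ((∫ x, ‖g x‖ ^ 2 : ℝ) : ℂ) := by
    rw [← h]; simp
  exact Complex.ofReal_injective h3

theorem slice_memLp {u : ℝ × ℝ → ℂ} (hu : MemLp u 2 volume) :
    ∀ᵐ x : ℝ, MemLp (fun z => u (x, z)) 2 (volume : Measure ℝ) := by
  have h1 : ∀ᵐ x : ℝ, AEStronglyMeasurable (fun z => u (x, z)) (volume : Measure ℝ) :=
    AEStronglyMeasurable.prodMk_left (μ := volume) (ν := volume) hu.1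
  have h2 : ∀ᵐ x : ℝ, Integrable (fun z => ‖u (x, z)‖ ^ 2) (volume : Measure ℝ) :=
    Integrable.prod_right_ae (μ := volume) (ν := volume)
      ((memLp_two_iff_integrable_sq_norm hu.1).1 hu)
  filter_upwards [h1, h2] with x a b
  exact (memLp_two_iff_integrable_sq_norm a).2 b

theorem slice_int {v : ℝ → ℂ} (hv : MemLp v 2 volume) (f : HH) :
    Integrable (fun z => v z * f z) volume :=
  hv.integrable_mul (Lp.memLp f)

theorem slice_bound {v : ℝ → ℂ} (hv : MemLp v 2 volume) (f : HH) :
    ‖∫ z, v z * f z‖ ^ 2 ≤ ‖f‖ ^ 2 * ∫ z, ‖v z‖ ^ 2 := by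
  have hs : MemLp (fun z => (starRingEnd ℂ) (v z)) 2 (volume : Measure ℝ) := hv.star
  have e : ∫ z, v z * f z = ⟪hs.toLp _, f⟫_ℂ := by
    rw [L2.inner_def]
    refine integral_congr_ae ?_
    filter_upwards [hs.coeFn_toLp] with z hz
    rw [hz, RCLike.inner_apply]; simp [mul_comm]
  have e2 : ∫ z, ‖v z‖ ^ 2 = ‖hs.toLp _‖ ^ 2 := by
    rw [norm_sq_HH]
    refine integral_congr_ae ?_
    filter_upwards [hs.coeFn_toLp] with z hz
    rw [hz]; simp
  rw [e, e2, ← mul_pow, mul_comm]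
  gcongr
  exact norm_inner_le_norm _ _

theorem K_memLp {u : ℝ × ℝ → ℂ} (hu : MemLp u 2 volume) (f : HH) :
    MemLp (fun x : ℝ => ∫ z : ℝ, u (x, z) * f z) 2 (volume : Measure ℝ) ∧
    ∫ x : ℝ, ‖∫ z : ℝ, u (x, z) * f z‖ ^ 2 ≤ ‖f‖ ^ 2 * ∫ p, ‖u p‖ ^ 2 := by
  have hm : AEStronglyMeasurable (fun x : ℝ => ∫ z : ℝ, u (x, z) * f z) (volume : Measure ℝ) := by
    have : AEStronglyMeasurable (fun p : ℝ × ℝ => u p * f p.2)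
        ((volume : Measure ℝ).prod (volume : Measure ℝ)) :=
      AEStronglyMeasurable.mul hu.1 ((Lp.aestronglyMeasurable f).comp_snd)
    exact this.integral_prod_right'
  have hi : Integrable (fun p => ‖u p‖ ^ 2) ((volume : Measure ℝ).prod (volume : Measure ℝ)) :=
    (memLp_two_iff_integrable_sq_norm hu.1).1 hu
  have hb : ∀ᵐ x : ℝ, ‖∫ z : ℝ, u (x, z) * f z‖ ^ 2 ≤ ‖f‖ ^ 2 * ∫ z, ‖u (x, z)‖ ^ 2 := by
    filter_upwards [slice_memLp hu] with x hx
    exact slice_bound hx f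
  have hi2 : Integrable (fun x => ‖f‖ ^ 2 * ∫ z, ‖u (x, z)‖ ^ 2) volume :=
    hi.integral_prod_left.const_mul _
  have hi3 : Integrable (fun x : ℝ => ‖∫ z : ℝ, u (x, z) * f z‖ ^ 2) volume := by
    refine hi2.mono' (hm.norm.pow 2) ?_
    filter_upwards [hb] with x hx
    rw [Real.norm_of_nonneg (by positivity)]; exact hx
  refine ⟨(memLp_two_iff_integrable_sq_norm hm).2 hi3, ?_⟩
  refine (integral_mono_ae hi3 hi2 hb).trans_eq ?_
  rw [integral_const_mul]
  congr 1
  exact (integral_prod _ hi).symm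

/-- integral operator with kernel `u` -/
def Lk (u : ℝ × ℝ → ℂ) (hu : MemLp u 2 volume) : HH →L[ℂ] HH :=
  LinearMap.mkContinuous
    { toFun := fun f => (K_memLp hu f).1.toLp _
      map_add' := by
        intro f g
        apply Lp.ext
        filter_upwards [(K_memLp hu (f + g)).1.coeFn_toLp, (K_memLp hu f).1.coeFn_toLp,
          (K_memLp hu g).1.coeFn_toLp, slice_memLp hu,
          Lp.coeFn_add ((K_memLp hu f).1.toLp _) ((K_memLp hu g).1.toLp _)] with x h1 h2 h3 h4 h5
        rw [h5, Pi.add_apply, h1, h2, h3, ← integral_add (slice_int h4 f) (slice_int h4 g)]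
        refine integral_congr_ae ?_
        filter_upwards [Lp.coeFn_add f g] with z hz
        rw [hz, Pi.add_apply, mul_add]
      map_smul' := by
        intro c f
        apply Lp.ext
        filter_upwards [(K_memLp hu (c • f)).1.coeFn_toLp, (K_memLp hu f).1.coeFn_toLp,
          Lp.coeFn_smul c ((K_memLp hu f).1.toLp _)] with x h1 h2 h5
        rw [RingHom.id_apply, h5, Pi.smul_apply, h1, h2, smul_eq_mul, ← integral_const_mul]
        refine integral_congr_ae ?_
        filter_upwards [Lp.coeFn_smul c f] with z hz
        rw [hz, Pi.smul_apply, smul_eq_mul]; ring }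
    (Real.sqrt (∫ p, ‖u p‖ ^ 2)) (by
      intro f
      apply le_of_sq_le_sq _ (by positivity)
      rw [mul_pow, Real.sq_sqrt (by positivity), norm_sq_HH]
      refine le_trans (le_of_eq ?_) ((K_memLp hu f).2.trans_eq (mul_comm _ _))
      refine integral_congr_ae ?_
      filter_upwards [(K_memLp hu f).1.coeFn_toLp] with x h1
      simp only [LinearMap.coe_mk, AddHom.coe_mk]
      rw [h1])

theorem Lk_coe (u : ℝ × ℝ → ℂ) (hu : MemLp u 2 volume) (f : HH) :
    Lk u hu f =ᵐ[volume] fun x : ℝ => ∫ z : ℝ, u (x, z) * f z :=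
  (K_memLp hu f).1.coeFn_toLp

theorem Lk_norm (u : ℝ × ℝ → ℂ) (hu : MemLp u 2 volume) (f : HH) :
    ‖Lk u hu f‖ ^ 2 ≤ ‖f‖ ^ 2 * ∫ p, ‖u p‖ ^ 2 := by
  refine le_trans (le_of_eq ?_) (K_memLp hu f).2
  rw [norm_sq_HH]
  refine integral_congr_ae ?_
  filter_upwards [Lk_coe u hu f] with x h1
  rw [h1]

theorem tensor_test {η φ : ℝ → ℝ} (hη : IsT η) (hφ : IsT φ) :
    IsTest (fun p => η p.1 * φ p.2) := by
  refine ⟨(hη.1.comp contDiff_fst).mul (hφ.1.comp contDiff_snd), ?_⟩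
  refine HasCompactSupport.intro (hη.2.isCompact.prod hφ.2.isCompact) ?_
  intro p hp
  by_cases h1 : p.1 ∈ tsupport η
  · have : p.2 ∉ tsupport φ := fun h2 => hp ⟨h1, h2⟩
    rw [image_eq_zero_of_notMem_tsupport this, mul_zero]
  · rw [image_eq_zero_of_notMem_tsupport h1, zero_mul]

theorem Lk_pair {u : ℝ × ℝ → ℂ} (hu : MemLp u 2 volume) {η φ : ℝ → ℝ} (hη : IsT η) (hφ : IsT φ) :
    ⟪cl η hη, Lk u hu (cl φ hφ)⟫_ℂ = ∫ p, u p * ((η p.1 * φ p.2 : ℝ) : ℂ) := by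
  have ht := tensor_test hη hφ
  have hm : MemLp (fun p : ℝ × ℝ => ((η p.1 * φ p.2 : ℝ) : ℂ)) 2
      (volume : Measure (ℝ × ℝ)) :=
    (Complex.continuous_ofReal.comp ht.1.continuous).memLp_of_hasCompactSupport
      (ht.2.comp_left (g := fun y : ℝ => (y : ℂ)) (by simp))
  have hi : Integrable (fun p : ℝ × ℝ => u p * ((η p.1 * φ p.2 : ℝ) : ℂ))
      ((volume : Measure ℝ).prod volume) := hu.integrable_mul hm
  rw [inner_cl]
  refine Eq.trans ?_ (integral_prod _ hi).symm
  refine integral_congr_ae ?_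
  filter_upwards [Lk_coe u hu (cl φ hφ)] with x hx
  rw [hx, ← integral_mul_const]
  refine integral_congr_ae ?_
  filter_upwards [cl_coe hφ] with z hz
  rw [hz]; push_cast; ring

theorem Lk_WD {u v : ℝ × ℝ → ℂ} (hu : MemLp u 2 volume) (hv : MemLp v 2 volume)
    (hw : IsWeakPdx u v) {φ : ℝ → ℝ} (hφ : IsT φ) :
    WD (Lk u hu (cl φ hφ)) (Lk v hv (cl φ hφ)) := by
  intro η hη
  rw [Lk_pair, Lk_pair, ← hw _ (tensor_test hη hφ)]
  congr 1; ext p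
  have : pdxR (fun p => η p.1 * φ p.2) p = deriv η p.1 * φ p.2 := by
    simp only [pdxR]
    exact deriv_mul_const (hη.1.differentiable (by simp) _) _
  rw [this]

theorem Lk_z {u v : ℝ × ℝ → ℂ} (hu : MemLp u 2 volume) (hv : MemLp v 2 volume)
    (hw : IsWeakPdz u v) {φ : ℝ → ℝ} (hφ : IsT φ) :
    Lk u hu (cl _ hφ.deriv) = - Lk v hv (cl φ hφ) := by
  rw [← sub_eq_zero]
  apply eq_zero_of_inner_cl
  intro η hη
  rw [inner_sub_right, inner_neg_right, Lk_pair, Lk_pair, sub_eq_zero, ← hw _ (tensor_test hη hφ)]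
  congr 1; ext p
  have : pdzR (fun p => η p.1 * φ p.2) p = η p.1 * deriv φ p.2 := by
    simp only [pdzR]
    exact deriv_const_mul _ (hφ.1.differentiable (by simp) _)
  rw [this]

theorem Lk_eq {u v w : ℝ × ℝ → ℂ} (hu : MemLp u 2 volume) (hv : MemLp v 2 volume)
    (hw : MemLp w 2 volume) (q : ℝ → ℝ)
    (heq : ∀ᵐ p : ℝ × ℝ, v p + w p + ((q p.1 : ℝ) : ℂ) * u p = 0) (f : HH) :
    ∀ᵐ x : ℝ, (Lk w hw f + Lk v hv f : HH) x = - (q x : ℂ) * Lk u hu f x := by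
  have h := Measure.ae_ae_of_ae_prod (μ := (volume : Measure ℝ)) (ν := (volume : Measure ℝ)) heq
  filter_upwards [h, slice_memLp hu, slice_memLp hv, slice_memLp hw, Lk_coe u hu f, Lk_coe v hv f,
    Lk_coe w hw f, Lp.coeFn_add (Lk w hw f) (Lk v hv f)] with x h1 h2 h3 h4 h5 h6 h7 h8
  rw [h8, Pi.add_apply, h5, h6, h7, ← integral_add (slice_int h4 f) (slice_int h3 f),
    ← integral_const_mul]
  refine integral_congr_ae ?_
  filter_upwards [h1] with z hz
  linear_combination (f z) * hz

theorem Lk_symm {u v w ux uz: ℝ × ℝ → ℂ} (hu : MemLp u 2 volume) (hv : MemLp v 2 volume)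
    (hw : MemLp w 2 volume) (hux : MemLp ux 2 volume) (huz : MemLp uz 2 volume) (q : ℝ → ℝ)
    (hwx : IsWeakPdx u ux) (hwz : IsWeakPdz u uz)
    (hwxx : IsWeakPdx ux v) (hwzz : IsWeakPdz uz w)
    (heq : ∀ᵐ p : ℝ × ℝ, v p + w p + ((q p.1 : ℝ) : ℂ) * u p = 0)
    {φ ψ : ℝ → ℝ} (hφ : IsT φ) (hψ : IsT ψ) :
    ⟪Lk u hu (cl _ hφ.deriv.deriv), Lk u hu (cl ψ hψ)⟫_ℂ =
    ⟪Lk u hu (cl φ hφ), Lk u hu (cl _ hψ.deriv.deriv)⟫_ℂ := by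
  have key : ∀ {φ : ℝ → ℝ} (hφ : IsT φ), Lk u hu (cl _ hφ.deriv.deriv) = Lk w hw (cl φ hφ) := by
    intro φ hφ
    rw [Lk_z hu huz hwz hφ.deriv, Lk_z huz hw hwzz hφ, neg_neg]
  rw [key hφ, key hψ]
  have p1 := WD_parts (Lk_WD hux hv hwxx hφ) (Lk_WD hu hux hwx hψ)
  have p2 := WD_parts (Lk_WD hu hux hwx hφ) (Lk_WD hux hv hwxx hψ)
  have p3 : ⟪Lk w hw (cl φ hφ) + Lk v hv (cl φ hφ), Lk u hu (cl ψ hψ)⟫_ℂ =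
      ⟪Lk u hu (cl φ hφ), Lk w hw (cl ψ hψ) + Lk v hv (cl ψ hψ)⟫_ℂ := by
    rw [L2.inner_def, L2.inner_def]
    refine integral_congr_ae ?_
    filter_upwards [Lk_eq hu hv hw q heq (cl φ hφ), Lk_eq hu hv hw q heq (cl ψ hψ)] with x h1 h2
    rw [h1, h2, RCLike.inner_apply, RCLike.inner_apply]
    simp only [map_mul, map_neg, Complex.conj_ofReal]
    ring
  rw [inner_add_left, inner_add_right] at p3
  linear_combination p3 - p1 + p2

theorem Lk_decay {u : ℝ × ℝ → ℂ} (hu : MemLp u 2 volume) {φ : ℝ → ℝ} (hφ : IsT φ) :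
    Tendsto (fun s => Lk u hu (TT s (cl φ hφ))) atTop (𝓝 0) := by
  obtain ⟨R, hR⟩ : ∃ R : ℝ, ∀ x, R ≤ |x| → φ x = 0 := by
    obtain ⟨R, hR⟩ := hφ.2.isCompact.isBounded.subset_closedBall (0 : ℝ)
    refine ⟨R + 1, fun x hx => image_eq_zero_of_notMem_tsupport fun h => ?_⟩
    have := hR h
    rw [Metric.mem_closedBall, dist_zero_right, Real.norm_eq_abs] at this
    linarith
  let S : ℝ → Set (ℝ × ℝ) := fun s => {p | |p.2 + s| < R}
  have hS : ∀ s, MeasurableSet (S s) := fun s =>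
    (isOpen_lt (by fun_prop) continuous_const).measurableSet
  have hus : ∀ s, MemLp ((S s).indicator u) 2 volume := fun s => hu.indicator (hS s)
  have hi : Integrable (fun p => ‖u p‖ ^ 2) volume := (memLp_two_iff_integrable_sq_norm hu.1).1 hu
  have e : ∀ s, Lk u hu (TT s (cl φ hφ)) = Lk _ (hus s) (TT s (cl φ hφ)) := by
    intro s
    apply Lp.ext
    filter_upwards [Lk_coe u hu (TT s (cl φ hφ)), Lk_coe _ (hus s) (TT s (cl φ hφ))] with x h1 h2
    rw [h1, h2]
    refine integral_congr_ae ?_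
    rw [TT_cl]
    filter_upwards [cl_coe (hφ.shift s)] with z hz
    rw [hz]
    by_cases hp : (x, z) ∈ S s
    · rw [indicator_of_mem hp]
    · have : φ (z + s) = 0 := hR _ (not_lt.1 hp)
      rw [this]; simp
  have t : Tendsto (fun s => ∫ p, ‖(S s).indicator u p‖ ^ 2) atTop (𝓝 0) := by
    have := tendsto_integral_filter_of_dominated_convergence (l := (atTop : Filter ℝ))
      (μ := (volume : Measure (ℝ × ℝ)))
      (F := fun s p => ‖(S s).indicator u p‖ ^ 2) (f := fun _ => 0) (fun p => ‖u p‖ ^ 2)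
      (Eventually.of_forall fun s => (hus s).1.norm.pow 2)
      (Eventually.of_forall fun s => Eventually.of_forall fun p => by
        rw [Real.norm_of_nonneg (by positivity)]
        gcongr
        exact norm_indicator_le_norm_self _ _) hi
      (Eventually.of_forall fun p => by
        apply tendsto_const_nhds.congr'
        filter_upwards [eventually_ge_atTop (R - p.2)] with s hs
        have : p ∉ S s := by
          intro h
          have h' : |p.2 + s| < R := h
          have := (abs_lt.1 h').2
          linarith
        rw [indicator_of_notMem this]; simp)
    simpa using this
  have t2 : Tendsto (fun s => ‖Lk u hu (TT s (cl φ hφ))‖ ^ 2) atTop (𝓝 0) := by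
    refine squeeze_zero (fun s => by positivity) (fun s => ?_)
      (by simpa using t.const_mul (‖cl φ hφ‖ ^ 2))
    rw [e s]
    refine (Lk_norm _ (hus s) _).trans_eq ?_
    rw [(TT s).norm_map]
  rw [tendsto_zero_iff_norm_tendsto_zero]
  have := t2.sqrt
  simpa using this

theorem final_zero {u : ℝ × ℝ → ℂ} (hu : MemLp u 2 volume)
    (hz : ∀ φ (hφ : IsT φ), Lk u hu (cl φ hφ) = 0) : ∀ᵐ p : ℝ × ℝ, u p = 0 := by
  have : Fact ((2 : ℝ≥0∞) ≠ (⊤ : ℝ≥0∞)) := ⟨by norm_num⟩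
  let D : Set HH := {f | ∃ φ, ∃ h : IsT φ, f = cl φ h}
  obtain ⟨t, htD, htc, hDt⟩ :=
    (TopologicalSpace.IsSeparable.of_separableSpace D).exists_countable_dense_subset
  have h1 : ∀ᵐ x : ℝ, ∀ f ∈ t, ∫ z, u (x, z) * f z = 0 := by
    rw [ae_ball_iff htc]
    intro f hf
    obtain ⟨φ, h, rfl⟩ := htD hf
    have e := Lk_coe u hu (cl φ h)
    rw [hz φ h] at e
    filter_upwards [e, Lp.coeFn_zero ℂ 2 (volume : Measure ℝ)] with x hx h0
    rw [← hx, h0]; rfl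
  have h2 : ∀ᵐ x : ℝ, ∀ᵐ z : ℝ, u (x, z) = 0 := by
    filter_upwards [h1, slice_memLp hu] with x hx hm
    have hg : ∀ f : HH, ∫ z, u (x, z) * f z = ⟪hm.star.toLp _, f⟫_ℂ := by
      intro f
      rw [L2.inner_def]
      refine integral_congr_ae ?_
      filter_upwards [hm.star.coeFn_toLp] with z hz
      rw [hz, RCLike.inner_apply]; simp [mul_comm]
    have hcl : IsClosed {f : HH | ⟪hm.star.toLp _, f⟫_ℂ = 0} :=
      isClosed_eq (continuous_const.inner continuous_id) continuous_const
    have hsub : D ⊆ {f : HH | ⟪hm.star.toLp _, f⟫_ℂ = 0} :=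
      hDt.trans (closure_minimal (fun f hf => by
        change ⟪hm.star.toLp _, f⟫_ℂ = 0
        rw [← hg]; exact hx f hf) hcl)
    have h0 : hm.star.toLp _ = (0 : HH) := by
      apply eq_zero_of_inner_cl
      intro φ h
      rw [inner_eq_zero_symm]
      exact hsub ⟨φ, h, rfl⟩
    have h0' := (Lp.eq_zero_iff_ae_eq_zero).1 h0
    filter_upwards [h0', hm.star.coeFn_toLp] with z a b
    rw [b] at a
    simpa using a
  have hmk := hu.1.ae_eq_mk
  have hmk2 := Measure.ae_ae_of_ae_prod (μ := (volume : Measure ℝ)) (ν := (volume : Measure ℝ)) hmk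
  have h3 : ∀ᵐ p : ℝ × ℝ, hu.1.mk u p = 0 := by
    refine (Measure.ae_prod_iff_ae_ae (μ := (volume : Measure ℝ)) (ν := (volume : Measure ℝ))
      ?_).2 ?_
    · exact hu.1.stronglyMeasurable_mk.measurable (measurableSet_singleton 0)
    · filter_upwards [h2, hmk2] with x a b
      filter_upwards [a, b] with z a b
      rw [← b, a]
  filter_upwards [hmk, h3] with p a b
  rw [a, b]

/-- **Theorem.**  The homogeneous Helmholtz equation `Δu + k² n(x)² u = 0` on `ℝ²`, with a
bounded measurable index of refraction `n` depending only on `x` and equal to the constant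
`n_cl > 0` for `|x| > h`, has no nontrivial solution of Sobolev class `H²(ℝ²)`:
if `u ∈ H²(ℝ²)` (i.e. `u` and its weak derivatives up to order two are square integrable)
satisfies the equation almost everywhere, then `u = 0` almost everywhere. -/
theorem no_nontrivial_H2_solution
    (h k ncl : ℝ) (hh : 0 < h) (hk : 0 < k) (hncl : 0 < ncl)
    (n : ℝ → ℝ) (hn_meas : Measurable n) (hn_bdd : ∃ C, ∀ x, |n x| ≤ C)
    (hn_cl : ∀ x, h < |x| → n x = ncl)
    -- u ∈ H²(ℝ²): u together with weak derivatives up to order two in L²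
    (u ux uz uxx uxz uzz : ℝ × ℝ → ℂ)
    (hu : MemLp u 2 (volume : Measure (ℝ × ℝ)))
    (hux : MemLp ux 2 (volume : Measure (ℝ × ℝ)))
    (huz : MemLp uz 2 (volume : Measure (ℝ × ℝ)))
    (huxx : MemLp uxx 2 (volume : Measure (ℝ × ℝ)))
    (huxz : MemLp uxz 2 (volume : Measure (ℝ × ℝ)))
    (huzz : MemLp uzz 2 (volume : Measure (ℝ × ℝ)))
    (hwx : IsWeakPdx u ux) (hwz : IsWeakPdz u uz)
    (hwxx : IsWeakPdx ux uxx) (hwxz : IsWeakPdz ux uxz)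
    (hwzz : IsWeakPdz uz uzz)
    -- the Helmholtz equation holds almost everywhere
    (heq : ∀ᵐ p : ℝ × ℝ, uxx p + uzz p + ((k ^ 2 * (n p.1) ^ 2 : ℝ) : ℂ) * u p = 0) :
    ∀ᵐ p : ℝ × ℝ, u p = 0 := by
  apply final_zero hu
  intro φ hφ
  have hsq : ∀ s, ∀ f : HH, ‖Lk u hu (TT s f)‖ ≤ ‖Lk u hu‖ * ‖f‖ := fun s f => by
    have := (Lk u hu).le_opNorm (TT s f)
    rwa [(TT s).norm_map] at this
  have hd : ∀ {ψ : ℝ → ℝ} (hψ : IsT ψ) (s : ℝ),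
      HasDerivAt (fun s => Lk u hu (TT s (cl ψ hψ))) (Lk u hu (TT s (cl _ hψ.deriv))) s := by
    intro ψ hψ s
    have := TT_hasDerivAt (cl_WD hψ) s
    exact ((Lk u hu).restrictScalars ℝ).hasFDerivAt.comp_hasDerivAt s this
  have := abstract_zero (A0 := fun s => Lk u hu (TT s (cl φ hφ)))
    (A1 := fun s => Lk u hu (TT s (cl _ hφ.deriv)))
    (A2 := fun s => Lk u hu (TT s (cl _ hφ.deriv.deriv)))
    (hd hφ) (hd hφ.deriv)
    (max (‖Lk u hu‖ * ‖cl φ hφ‖) (‖Lk u hu‖ * ‖cl _ hφ.deriv‖))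
    (fun s => (hsq s _).trans (le_max_left _ _)) (fun s => (hsq s _).trans (le_max_right _ _))
    (Lk_decay hu hφ) (Lk_decay hu hφ.deriv)
    (by
      intro s t
      have e : ∀ r, TT r (cl _ hφ.deriv.deriv) = cl _ (hφ.shift r).deriv.deriv := by
        intro r
        rw [TT_cl]
        congr 1
        rw [deriv_shift, deriv_shift]
      simp only [e]
      exact Lk_symm hu huxx huzz hux huz (fun x => k ^ 2 * (n x) ^ 2) hwx hwz hwxx hwzz heq
        (hφ.shift s) (hφ.shift t))
  simpa only [TT_zero] using this
end
end

section
/- Let T > 0, h > 0, d > 0, and let q : [−h, h] → ℝ be measurable with 0 ≤ q(x) ≤ d². Set B = √( cosh²(Th) + sinh²(Th)/(Th)² ). For τ ∈ ℂ with |τ| ≤ d and |Im τ| ≤ T, set λ = d² + τ², and let φ_s, φ_a : [−h, h] → ℂ be the solutions of φ'' + (λ − q(x)) φ = 0 with φ_s(0) = 1, φ_s'(0) = 0 and φ_a(0) = 0, φ_a'(0) = √λ (principal branch). Then for all x ∈ [−h, h]: |φ_s(x)| ≤ cosh(Th) · exp(B d² h²/2) and |φ_a(x)| ≤ √2 ·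 d h B · exp(B d² h²/2). -/
open MeasureTheory Set Complex
open scoped ENNReal NNReal

noncomputable section

lemma aux_gronwall (b A h : ℝ) (hb : 0 ≤ b) (hA : 0 ≤ A) (f : ℝ → ℝ) (hf : Continuous f)
    (hf0 : ∀ x, 0 ≤ f x)
    (H : ∀ x ∈ Icc 0 h, f x ≤ A + b * ∫ s in (0:ℝ)..x, (x - s) * f s) :
    ∀ x ∈ Icc 0 h, f x ≤ A * Real.exp (b * h ^ 2 / 2) := by
  intro x0 hx0
  set v : ℝ → ℝ := fun x => A + b * ∫ s in (0:ℝ)..x, (x0 - s) * f s with hv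
  have hcont : Continuous (fun s => (x0 - s) * f s) := by fun_prop
  have hvd : ∀ x, HasDerivAt v (b * ((x0 - x) * f x)) x := fun x =>
    ((hcont.integral_hasStrictDerivAt 0 x).hasDerivAt.const_mul b).const_add A
  have hfv : ∀ x ∈ Icc 0 x0, f x ≤ v x := by
    intro x hx
    refine (H x ⟨hx.1, hx.2.trans hx0.2⟩).trans ?_
    simp only [hv]
    gcongr
    refine intervalIntegral.integral_mono_on hx.1 (Continuous.intervalIntegrable (by fun_prop) _ _)
      (hcont.intervalIntegrable _ _) ?_
    intro s hs
    exact mul_le_mul_of_nonneg_right (by linarith [hx.2]) (hf0 s)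
  set e : ℝ → ℝ := fun x => Real.exp (-(b * (x0 * x - x ^ 2 / 2))) with he
  have hed : ∀ x, HasDerivAt e (e x * (-(b * (x0 - x)))) x := by
    intro x
    have h1 : HasDerivAt (fun x : ℝ => -(b * (x0 * x - x ^ 2 / 2))) (-(b * (x0 - x))) x := by
      have := ((((hasDerivAt_id x).const_mul x0).sub
        (((hasDerivAt_id x).pow 2).div_const 2)).const_mul b).neg
      exact this.congr_deriv (by simp)
    exact h1.exp
  have hwd : ∀ x, HasDerivAt (fun x => v x * e x)
      (b * ((x0 - x) * f x) * e x + v x * (e x * (-(b * (x0 - x))))) x :=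
    fun x => (hvd x).mul (hed x)
  have hanti : AntitoneOn (fun x => v x * e x) (Icc 0 x0) := by
    refine antitoneOn_of_deriv_nonpos (convex_Icc _ _)
      (fun x _ => (hwd x).continuousAt.continuousWithinAt)
      (fun x _ => (hwd x).differentiableAt.differentiableWithinAt) ?_
    intro x hx
    rw [interior_Icc] at hx
    rw [(hwd x).deriv]
    have h1 := hfv x ⟨hx.1.le, hx.2.le⟩
    have h2 : 0 ≤ e x * (b * (x0 - x)) :=
      mul_nonneg (Real.exp_pos _).le (mul_nonneg hb (by linarith [hx.2]))
    nlinarith [mul_nonneg h2 (sub_nonneg.2 h1)]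
  have h3 := hanti (left_mem_Icc.2 hx0.1) (right_mem_Icc.2 hx0.1) hx0.1
  have h4 : v 0 * e 0 = A := by simp [hv, he]
  have h5 : f x0 * e x0 ≤ A :=
    (mul_le_mul_of_nonneg_right (hfv x0 (right_mem_Icc.2 hx0.1)) (Real.exp_pos _).le).trans
      (h3.trans h4.le)
  have h6 : e x0 * Real.exp (b * x0 ^ 2 / 2) = 1 := by
    simp only [he]
    rw [← Real.exp_add, Real.exp_eq_one_iff]; ring
  calc f x0 = f x0 * e x0 * Real.exp (b * x0 ^ 2 / 2) := by rw [mul_assoc, h6, mul_one]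
    _ ≤ A * Real.exp (b * x0 ^ 2 / 2) := by gcongr
    _ ≤ A * Real.exp (b * h ^ 2 / 2) := by
      have := hx0.1
      have := hx0.2
      gcongr

lemma aux_core (h D C : ℝ) (hh : 0 ≤ h) (hC : 0 ≤ C) (τ : ℂ) (φ φd p : ℝ → ℂ)
    (hp : ∀ x ∈ Icc 0 h, ‖p x‖ ≤ D)
    (h1 : ∀ x ∈ Icc 0 h, HasDerivWithinAt φ (φd x) (Icc 0 h) x)
    (h2 : ∀ x ∈ Icc 0 h, HasDerivWithinAt φd (-((τ ^ 2 + p x) * φ x)) (Icc 0 h) x)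
    (k c : ℝ → ℂ) (hk : ∀ y, HasDerivAt k (c y) y) (hc : ∀ y, HasDerivAt c (-τ ^ 2 * k y) y)
    (hk0 : k 0 = 0) (hc0 : c 0 = 1) (kb : ∀ y ∈ Icc 0 h, ‖k y‖ ≤ C * y)
    (A : ℝ) (hA : ∀ x ∈ Icc 0 h, ‖φ 0 * c x + φd 0 * k x‖ ≤ A) :
    ∀ x ∈ Icc 0 h, ‖φ x‖ ≤ A * Real.exp (C * D * h ^ 2 / 2) := by
  have hφc : ContinuousOn φ (Icc 0 h) := fun x hx => (h1 x hx).continuousWithinAt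
  have hφdc : ContinuousOn φd (Icc 0 h) := fun x hx => (h2 x hx).continuousWithinAt
  have hD : 0 ≤ D := (norm_nonneg _).trans (hp 0 (left_mem_Icc.2 hh))
  have hA0 : 0 ≤ A := (norm_nonneg _).trans (hA 0 (left_mem_Icc.2 hh))
  set f : ℝ → ℝ := fun x => ‖φ (projIcc 0 h hh x)‖ with hf
  have hfc : Continuous f :=
    (hφc.comp_continuous (continuous_subtype_val.comp continuous_projIcc)
      (fun x => (projIcc 0 h hh x).2)).norm
  have hff : ∀ x ∈ Icc 0 h, f x = ‖φ x‖ := by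
    intro x hx
    simp [hf, projIcc_of_mem hh hx]
  have key := aux_gronwall (C * D) A h (mul_nonneg hC hD) hA0 f hfc (fun x => norm_nonneg _) ?_
  · intro x hx
    rw [← hff x hx]; exact key x hx
  intro x hx
  rw [hff x hx]
  have hcont : Continuous (fun s => (x - s) * f s) := by fun_prop
  have hsub : Icc 0 x ⊆ Icc 0 h := Icc_subset_Icc_right hx.2
  set G : ℝ → ℂ := fun t => φ t * c (x - t) + φd t * k (x - t) with hG
  have hGd : ∀ t ∈ Icc 0 h, HasDerivWithinAt G (-(p t * φ t * k (x - t))) (Icc 0 h) t := by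
    intro t ht
    have e1 : HasDerivAt (fun t => c (x - t)) (τ ^ 2 * k (x - t)) t := by
      simpa using (hc (x - t)).comp_const_sub x t
    have e2 : HasDerivAt (fun t => k (x - t)) (-c (x - t)) t := by
      simpa using (hk (x - t)).comp_const_sub x t
    exact (((h1 t ht).mul e1.hasDerivWithinAt).add
      ((h2 t ht).mul e2.hasDerivWithinAt)).congr_deriv (by ring)
  have hbd := image_norm_le_of_norm_deriv_right_le_deriv_boundary' (f := G) (a := 0) (b := x)
    (f' := fun t => -(p t * φ t * k (x - t)))
    (B := fun t => A + C * D * ∫ s in (0:ℝ)..t, (x - s) * f s)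
    (B' := fun t => C * D * ((x - t) * f t))
    (fun t ht => (hGd t (hsub ht)).continuousWithinAt.mono hsub)
    (fun t ht => (hGd t (hsub ⟨ht.1, ht.2.le⟩)).mono_of_mem_nhdsWithin
      (Icc_mem_nhdsGE_of_mem ⟨ht.1, ht.2.trans_le hx.2⟩))
    (by simpa [hG] using hA x hx)
    (fun t _ => (((hcont.integral_hasStrictDerivAt 0 t).hasDerivAt.const_mul
      (C * D)).const_add A).continuousAt.continuousWithinAt)
    (fun t _ => (((hcont.integral_hasStrictDerivAt 0 t).hasDerivAt.const_mul
      (C * D)).const_add A).hasDerivWithinAt)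
    (by
      intro t ht
      have ht' : t ∈ Icc 0 h := hsub ⟨ht.1, ht.2.le⟩
      rw [hff t ht', norm_neg, norm_mul, norm_mul]
      have a1 := hp t ht'
      have a2 := kb (x - t) ⟨by linarith [ht.2], by linarith [ht.1, hx.2]⟩
      calc ‖p t‖ * ‖φ t‖ * ‖k (x - t)‖ ≤ D * ‖φ t‖ * (C * (x - t)) := by gcongr
        _ = _ := by ring)
    (right_mem_Icc.2 hx.1)
  simpa [hG, hk0, hc0] using hbd

lemma aux_cos (z : ℂ) (S : ℝ) (hz : |z.im| ≤ S) : ‖Complex.cos z‖ ≤ Real.cosh S := by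
  have h1 : ‖Complex.cos z‖ ^ 2 ≤ Real.cosh z.im ^ 2 := by
    rw [← Complex.normSq_eq_norm_sq, Complex.normSq_apply, Complex.cos_eq]
    simp only [← Complex.ofReal_cos, ← Complex.ofReal_sin, ← Complex.ofReal_cosh,
      ← Complex.ofReal_sinh, Complex.sub_re, Complex.sub_im, Complex.mul_re, Complex.mul_im,
      Complex.ofReal_re, Complex.ofReal_im, Complex.I_re, Complex.I_im]
    have e1 := Real.sin_sq_add_cos_sq z.re
    have e2 := Real.cosh_sq z.im
    nlinarith [mul_nonneg (sq_nonneg (Real.sin z.re)) (sq_nonneg (Real.cosh z.im)),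
      sq_nonneg (Real.sin z.re)]
  have h2 : ‖Complex.cos z‖ ≤ Real.cosh z.im :=
    le_of_sq_le_sq h1 (Real.cosh_pos _).le
  refine h2.trans (Real.cosh_le_cosh.2 (hz.trans (le_abs_self S)))

lemma aux_sin (z : ℂ) (S : ℝ) (hz : |z.im| ≤ S) : ‖Complex.sin z‖ ≤ Real.cosh S * ‖z‖ := by
  have hconv : Convex ℝ {w : ℂ | |w.im| ≤ S} := by
    have : {w : ℂ | |w.im| ≤ S} = Complex.imLm ⁻¹' (Icc (-S) S) := by
      ext w; simp [abs_le]
    rw [this]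
    exact (convex_Icc _ _).linear_preimage _
  have := hconv.norm_image_sub_le_of_norm_hasDerivWithin_le (f := Complex.sin) (f' := Complex.cos)
    (C := Real.cosh S) (x := 0) (y := z)
    (fun w _ => (Complex.hasDerivAt_sin w).hasDerivWithinAt) (fun w hw => aux_cos w S hw)
    (by
      show |(0 : ℂ).im| ≤ S
      simpa using (abs_nonneg _).trans hz) hz
  simpa using this

lemma aux_kernel (τ : ℂ) (h T : ℝ) (hτ_im : |τ.im| ≤ T) :
    ∃ k c : ℝ → ℂ, (∀ y, HasDerivAt k (c y) y) ∧ (∀ y, HasDerivAt c (-τ ^ 2 * k y) y) ∧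
      k 0 = 0 ∧ c 0 = 1 ∧ (∀ y ∈ Icc 0 h, ‖k y‖ ≤ Real.cosh (T * h) * y) ∧
      (∀ y ∈ Icc 0 h, ‖c y‖ ≤ Real.cosh (T * h)) := by
  have him : ∀ y ∈ Icc 0 h, |(τ * (y : ℂ)).im| ≤ T * h := by
    intro y hy
    have : (τ * (y : ℂ)).im = τ.im * y := by simp
    rw [this, abs_mul, abs_of_nonneg hy.1]
    exact mul_le_mul hτ_im hy.2 hy.1 ((abs_nonneg _).trans hτ_im)
  have hlin : ∀ y : ℂ, HasDerivAt (fun y : ℂ => τ * y) τ y := by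
    intro y
    exact ((hasDerivAt_id y).const_mul τ).congr_deriv (by simp)
  have hcd : ∀ y : ℝ, HasDerivAt (fun y : ℝ => Complex.cos (τ * (y : ℂ)))
      (-Complex.sin (τ * y) * τ) y := fun y =>
    (hlin y).ccos.comp_ofReal
  have hsd : ∀ y : ℝ, HasDerivAt (fun y : ℝ => Complex.sin (τ * (y : ℂ)))
      (Complex.cos (τ * y) * τ) y := fun y =>
    (hlin y).csin.comp_ofReal
  by_cases h0 : τ = 0
  · subst h0
    refine ⟨fun y => (y : ℂ), fun _ => 1, fun y => ?_, fun y => ?_, by simp, rfl, ?_, ?_⟩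
    · exact (hasDerivAt_id (y : ℂ)).comp_ofReal
    · simpa using hasDerivAt_const y (1 : ℂ)
    · intro y hy
      rw [Complex.norm_real, Real.norm_of_nonneg hy.1]
      exact le_mul_of_one_le_left hy.1 (Real.one_le_cosh _)
    · intro y _
      simpa using Real.one_le_cosh _
  · refine ⟨fun y => Complex.sin (τ * y) / τ, fun y => Complex.cos (τ * y), fun y => ?_,
      fun y => ?_, by simp, by simp, ?_, ?_⟩
    · simpa [h0] using (hsd y).div_const τ
    · convert hcd y using 1
      field_simp
    · intro y hy
      rw [norm_div, div_le_iff₀ (norm_pos_iff.2 h0)]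
      refine (aux_sin _ _ (him y hy)).trans (le_of_eq ?_)
      rw [norm_mul, Complex.norm_real, Real.norm_of_nonneg hy.1]
      ring
    · intro y hy
      exact aux_cos _ _ (him y hy)

/-- Two-sided version. -/
lemma aux_two (h D C : ℝ) (hh : 0 ≤ h) (hC : 0 ≤ C) (τ : ℂ) (φ φd p : ℝ → ℂ)
    (hp : ∀ x ∈ Icc (-h) h, ‖p x‖ ≤ D)
    (h1 : ∀ x ∈ Icc (-h) h, HasDerivWithinAt φ (φd x) (Icc (-h) h) x)
    (h2 : ∀ x ∈ Icc (-h) h, HasDerivWithinAt φd (-((τ ^ 2 + p x) * φ x)) (Icc (-h) h) x)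
    (k c : ℝ → ℂ) (hk : ∀ y, HasDerivAt k (c y) y) (hc : ∀ y, HasDerivAt c (-τ ^ 2 * k y) y)
    (hk0 : k 0 = 0) (hc0 : c 0 = 1) (kb : ∀ y ∈ Icc 0 h, ‖k y‖ ≤ C * y)
    (A : ℝ) (hA : ∀ x ∈ Icc 0 h, ‖φ 0 * c x‖ + ‖φd 0 * k x‖ ≤ A) :
    ∀ x ∈ Icc (-h) h, ‖φ x‖ ≤ A * Real.exp (C * D * h ^ 2 / 2) := by
  have hsub : Icc 0 h ⊆ Icc (-h) h := Icc_subset_Icc_left (by linarith)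
  have hneg : ∀ x ∈ Icc 0 h, -x ∈ Icc (-h) h := fun x hx =>
    ⟨by linarith [hx.2], by linarith [hx.1]⟩
  have hmaps : MapsTo (fun x : ℝ => -x) (Icc 0 h) (Icc (-h) h) := hneg
  intro x hx
  rcases le_total 0 x with h0 | h0
  · exact aux_core h D C hh hC τ φ φd p (fun y hy => hp y (hsub hy))
      (fun y hy => (h1 y (hsub hy)).mono hsub) (fun y hy => (h2 y (hsub hy)).mono hsub)
      k c hk hc hk0 hc0 kb A (fun y hy => (norm_add_le _ _).trans (hA y hy)) x ⟨h0, hx.2⟩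
  · have := aux_core h D C hh hC τ (fun y => φ (-y)) (fun y => -φd (-y)) (fun y => p (-y))
      (fun y hy => hp _ (hneg y hy))
      (fun y hy => by
        simpa [Function.comp_def] using (h1 (-y) (hneg y hy)).scomp y
          (hasDerivAt_neg y).hasDerivWithinAt hmaps)
      (fun y hy => by
        exact ((h2 (-y) (hneg y hy)).scomp y
          (hasDerivAt_neg y).hasDerivWithinAt hmaps).neg.congr_deriv (by simp))
      k c hk hc hk0 hc0 kb A
      (fun y hy => (norm_add_le _ _).trans (by simpa using hA y hy)) (-x)
      ⟨by linarith, by linarith [hx.1]⟩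
    simpa using this

/-- **A priori bounds for the fundamental solutions (small `|τ|`).**  Let `0 ≤ q ≤ d²` on
`[-h,h]`, `λ = d² + τ²` with `|τ| ≤ d`, `|Im τ| ≤ T`, and set
`B = √(cosh²(Th) + sinh²(Th)/(Th)²)`.  If `φs, φa` solve `φ'' + (λ - q(x))φ = 0` on
`[-h,h]` with `φs(0)=1, φs'(0)=0` and `φa(0)=0, φa'(0)=√λ` (principal branch), then for
all `x ∈ [-h,h]`:
`|φs(x)| ≤ cosh(Th) exp(B d² h²/2)` and `|φa(x)| ≤ √2 d h B exp(B d² h²/2)`. -/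
theorem fundamental_solution_bound_small_tau
    (T h d : ℝ) (hT : 0 < T) (hh : 0 < h) (hd : 0 < d)
    (q : ℝ → ℝ) (hq_meas : Measurable q)
    (hq_bdd : ∀ x ∈ Set.Icc (-h) h, 0 ≤ q x ∧ q x ≤ d ^ 2)
    (τ : ℂ) (hτ_abs : ‖τ‖ ≤ d) (hτ_im : |τ.im| ≤ T)
    (φs φsd φa φad : ℝ → ℂ)
    (hφs : ∀ x ∈ Set.Icc (-h) h, HasDerivWithinAt φs (φsd x) (Set.Icc (-h) h) x)
    (hφsd : ∀ x ∈ Set.Icc (-h) h,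
      HasDerivWithinAt φsd
        (-((((d : ℂ) ^ 2 + τ ^ 2) - ((q x : ℝ) : ℂ)) * φs x)) (Set.Icc (-h) h) x)
    (hφa : ∀ x ∈ Set.Icc (-h) h, HasDerivWithinAt φa (φad x) (Set.Icc (-h) h) x)
    (hφad : ∀ x ∈ Set.Icc (-h) h,
      HasDerivWithinAt φad
        (-((((d : ℂ) ^ 2 + τ ^ 2) - ((q x : ℝ) : ℂ)) * φa x)) (Set.Icc (-h) h) x)
    (hinit_s : φs 0 = 1 ∧ φsd 0 = 0)
    (hinit_a : φa 0 = 0 ∧ φad 0 = ((d : ℂ) ^ 2 + τ ^ 2) ^ ((1 : ℂ) / 2)) :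
    ∀ x ∈ Set.Icc (-h) h,
      ‖φs x‖ ≤ Real.cosh (T * h) *
          Real.exp (Real.sqrt (Real.cosh (T * h) ^ 2 + Real.sinh (T * h) ^ 2 / (T * h) ^ 2)
            * d ^ 2 * h ^ 2 / 2) ∧
      ‖φa x‖ ≤ Real.sqrt 2 * d * h *
          Real.sqrt (Real.cosh (T * h) ^ 2 + Real.sinh (T * h) ^ 2 / (T * h) ^ 2) *
          Real.exp (Real.sqrt (Real.cosh (T * h) ^ 2 + Real.sinh (T * h) ^ 2 / (T * h) ^ 2)
            * d ^ 2 * h ^ 2 / 2) := by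
  set B := Real.sqrt (Real.cosh (T * h) ^ 2 + Real.sinh (T * h) ^ 2 / (T * h) ^ 2) with hB
  have hCB : Real.cosh (T * h) ≤ B := by
    apply Real.le_sqrt_of_sq_le
    have : 0 ≤ Real.sinh (T * h) ^ 2 / (T * h) ^ 2 := by positivity
    linarith
  have hB0 : 0 ≤ B := Real.sqrt_nonneg _
  obtain ⟨k, c, hk, hc, hk0, hc0, kb, cb⟩ := aux_kernel τ h T hτ_im
  have kb' : ∀ y ∈ Icc 0 h, ‖k y‖ ≤ B * y := fun y hy =>
    (kb y hy).trans (mul_le_mul_of_nonneg_right hCB hy.1)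
  have hp : ∀ x ∈ Icc (-h) h, ‖(((d ^ 2 - q x : ℝ)) : ℂ)‖ ≤ d ^ 2 := by
    intro x hx
    obtain ⟨a, b⟩ := hq_bdd x hx
    rw [Complex.norm_real, Real.norm_of_nonneg (by linarith)]
    linarith
  have hsq : ‖((d : ℂ) ^ 2 + τ ^ 2) ^ ((1 : ℂ) / 2)‖ ≤ Real.sqrt 2 * d := by
    set w := ((d : ℂ) ^ 2 + τ ^ 2) ^ ((1 : ℂ) / 2) with hw
    have e1 : w ^ 2 = (d : ℂ) ^ 2 + τ ^ 2 := by
      have := Complex.cpow_nat_inv_pow ((d : ℂ) ^ 2 + τ ^ 2) (two_ne_zero)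
      rw [hw, one_div]
      exact_mod_cast this
    have e2 : ‖w‖ ^ 2 ≤ 2 * d ^ 2 := by
      rw [← norm_pow, e1]
      refine (norm_add_le _ _).trans ?_
      rw [norm_pow, norm_pow, Complex.norm_real, Real.norm_of_nonneg hd.le]
      nlinarith [norm_nonneg τ]
    apply le_of_sq_le_sq _ (by positivity)
    rw [mul_pow, Real.sq_sqrt (by norm_num)]
    exact e2
  intro x hx
  constructor
  · refine aux_two h (d ^ 2) B hh.le hB0 τ φs φsd (fun x => ((d ^ 2 - q x : ℝ) : ℂ)) hp hφs ?_
      k c hk hc hk0 hc0 kb' _ ?_ x hx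
    · intro y hy
      convert hφsd y hy using 1
      push_cast; ring
    · intro y hy
      simpa [hinit_s.1, hinit_s.2] using cb y hy
  · refine aux_two h (d ^ 2) B hh.le hB0 τ φa φad (fun x => ((d ^ 2 - q x : ℝ) : ℂ)) hp hφa ?_
      k c hk hc hk0 hc0 kb' _ ?_ x hx
    · intro y hy
      convert hφad y hy using 1
      push_cast; ring
    · intro y hy
      rw [hinit_a.1, hinit_a.2, zero_mul, norm_zero, zero_add, norm_mul]
      calc _ ≤ (Real.sqrt 2 * d) * (B * h) := by
            gcongr
            exact (kb' y hy).trans (mul_le_mul_of_nonneg_left hy.2 hB0)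
        _ = _ := by ring
end
end
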